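/- arXiv:2108.03631 — 3 statements merged into one kernel-verified Lean document; each statement's English description precedes it below -/
import Mathlib

section
/- Main synchronization result in analytic form (L^2 synchronization of the nudged finite element solution, Section 6): Let ν, λ₁, G, c₀, C be positive real numbers, and let μ be a real number with μ ≥ 2C(c₀·exp(G⁴) + 1)·ν·λ₁·G². Let T be a real number and let g : ℝ → ℝ be a continuous nonnegative function such that ∫_t^{t+1/(νλ₁)} g(s) ds ≤ (c₀·exp(G⁴) + 1)·ν·λ₁·G² for every t ≥ T. Let Y : ℝ → ℝ be differentiable and nonnegative on [T,∞), and suppose Y′(t) + (μ − (C/(νλ₁))·g(t))·Y(t) ≤ 0 for every t ≥ T. Then for every t ≥ T, Y(t) ≤ Y(T)·exp(μ/(νλ₁))·exp(−C(c₀·exp(G⁴) + 1)·G²·ν·λ₁·(t − T)). In particular Y(t) → 0 at an exponential rate as t → ∞. -/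
/-- If the integrals of a nonnegative function over windows of length `τ` are at most `B`, then its
integral grows at most at rate `B / τ`, up to one window. -/
theorem intervalIntegral_le_of_window_bound {g : ℝ → ℝ} {τ B T t : ℝ} (hg : Continuous g)
    (hg_nonneg : ∀ s, 0 ≤ g s) (hτ : 0 < τ)
    (hB : ∀ t, T ≤ t → ∫ s in t..(t + τ), g s ≤ B) (ht : T ≤ t) :
    ∫ s in T..t, g s ≤ ((t - T) / τ + 1) * B := by
  have windows : ∀ n : ℕ, ∫ s in T..(T + n * τ), g s ≤ n * B := by
    intro n
    induction n with
    | zero => simp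
    | succ n ih =>
      have hsplit := intervalIntegral.integral_add_adjacent_intervals
        (hg.intervalIntegrable (μ := MeasureTheory.volume) T (T + n * τ))
        (hg.intervalIntegrable (T + n * τ) (T + n * τ + τ))
      have hlast := hB (T + n * τ) (by have : 0 ≤ n * τ := by positivity
                                       linarith)
      have hend : T + ((n + 1 : ℕ) : ℝ) * τ = T + n * τ + τ := by push_cast; ring
      rw [hend, ← hsplit]
      push_cast
      linarith
  have hB_nonneg : 0 ≤ B :=
    (intervalIntegral.integral_nonneg (by linarith) fun s _ => hg_nonneg s).trans (hB T le_rfl)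
  have hq : 0 ≤ (t - T) / τ := div_nonneg (by linarith) hτ.le
  set n := ⌈(t - T) / τ⌉₊
  have htn : t ≤ T + n * τ := by
    have := (div_le_iff₀ hτ).1 (Nat.le_ceil ((t - T) / τ))
    linarith
  calc ∫ s in T..t, g s ≤ ∫ s in T..(T + n * τ), g s :=
        intervalIntegral.integral_mono_interval le_rfl ht htn
          (Filter.Eventually.of_forall hg_nonneg) (hg.intervalIntegrable _ _)
    _ ≤ n * B := windows n
    _ ≤ ((t - T) / τ + 1) * B :=
        mul_le_mul_of_nonneg_right (Nat.ceil_lt_add_one hq).le hB_nonneg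

/-- Grönwall's inequality with a variable damping coefficient. -/
theorem le_mul_exp_neg_integral_of_deriv_add_mul_nonpos {Y Y' h : ℝ → ℝ} {T t : ℝ}
    (hh : Continuous h) (hY : ∀ t, T ≤ t → HasDerivAt Y (Y' t) t)
    (hineq : ∀ t, T ≤ t → Y' t + h t * Y t ≤ 0) (ht : T ≤ t) :
    Y t ≤ Y T * Real.exp (-∫ s in T..t, h s) := by
  have hderiv : ∀ x, T ≤ x → HasDerivAt (fun x => Y x * Real.exp (∫ s in T..x, h s))
      ((Y' x + h x * Y x) * Real.exp (∫ s in T..x, h s)) x := by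
    intro x hx
    refine ((hY x hx).fun_mul
      (hh.integral_hasStrictDerivAt T x).hasDerivAt.exp).congr_deriv ?_
    ring
  have hanti : AntitoneOn (fun x => Y x * Real.exp (∫ s in T..x, h s)) (Set.Ici T) := by
    refine antitoneOn_of_hasDerivWithinAt_nonpos (convex_Ici T)
      (fun x hx => (hderiv x hx).continuousAt.continuousWithinAt)
      (fun x hx => (hderiv x (interior_subset hx)).hasDerivWithinAt) fun x hx => ?_
    exact mul_nonpos_of_nonpos_of_nonneg (hineq x (interior_subset hx)) (Real.exp_nonneg _)
  have hle := hanti Set.self_mem_Ici ht ht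
  simp only [intervalIntegral.integral_same, Real.exp_zero, mul_one] at hle
  rwa [Real.exp_neg, ← div_eq_mul_inv, le_div_iff₀ (Real.exp_pos _)]

/-- Main synchronization result in analytic form: L² synchronization of the
nudged finite element solution.  `Y t` plays the role of `‖w^h(t)‖₀²` and
`g t` of `‖u^h(t)‖₂²` (suitably normalized). -/
theorem nudging_L2_synchronization
    (ν lam G c₀ C μ T : ℝ)
    (hν : 0 < ν) (hlam : 0 < lam) (hG : 0 < G) (hc₀ : 0 < c₀) (hC : 0 < C)
    (hμ : 2 * C * (c₀ * Real.exp (G ^ 4) + 1) * ν * lam * G ^ 2 ≤ μ)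
    (g : ℝ → ℝ) (hg_cont : Continuous g) (hg_nonneg : ∀ s, 0 ≤ g s)
    (hg_int : ∀ t, T ≤ t →
      (∫ s in t..(t + 1 / (ν * lam)), g s) ≤
        (c₀ * Real.exp (G ^ 4) + 1) * ν * lam * G ^ 2)
    (Y Y' : ℝ → ℝ)
    (hY_deriv : ∀ t, T ≤ t → HasDerivAt Y (Y' t) t)
    (hY_nonneg : ∀ t, T ≤ t → 0 ≤ Y t)
    (hY_ineq : ∀ t, T ≤ t → Y' t + (μ - (C / (ν * lam)) * g t) * Y t ≤ 0) :
    (∀ t, T ≤ t →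
      Y t ≤ Y T * Real.exp (μ / (ν * lam)) *
        Real.exp (-(C * (c₀ * Real.exp (G ^ 4) + 1) * G ^ 2 * ν * lam) * (t - T)))
    ∧ Filter.Tendsto Y Filter.atTop (nhds 0) := by
  have ha : 0 < ν * lam := mul_pos hν hlam
  set B := (c₀ * Real.exp (G ^ 4) + 1) * ν * lam * G ^ 2 with hB
  have hB_pos : 0 < B := by positivity
  have hCB : 0 < C * B := mul_pos hC hB_pos
  have hμB : 2 * (C * B) ≤ μ := by
    rw [hB]
    linarith
  have hrate : C * (c₀ * Real.exp (G ^ 4) + 1) * G ^ 2 * ν * lam = C * B := by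
    rw [hB]
    ring
  rw [hrate]
  have hdecay : ∀ t, T ≤ t →
      Y t ≤ Y T * Real.exp (μ / (ν * lam)) * Real.exp (-(C * B) * (t - T)) := by
    intro t ht
    refine (le_mul_exp_neg_integral_of_deriv_add_mul_nonpos
      (h := fun s => μ - C / (ν * lam) * g s) (by fun_prop) hY_deriv hY_ineq ht).trans ?_
    rw [mul_assoc, ← Real.exp_add]
    refine mul_le_mul_of_nonneg_left (Real.exp_le_exp.2 ?_) (hY_nonneg T le_rfl)
    rw [intervalIntegral.integral_sub (continuous_const.intervalIntegrable _ _)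
      ((hg_cont.intervalIntegrable _ _).const_mul _),
      intervalIntegral.integral_const, intervalIntegral.integral_const_mul, smul_eq_mul]
    have hint := mul_le_mul_of_nonneg_left
      (intervalIntegral_le_of_window_bound hg_cont hg_nonneg (one_div_pos.2 ha) hg_int ht)
      (div_pos hC ha).le
    have hexpand : C / (ν * lam) * (((t - T) / (1 / (ν * lam)) + 1) * B) =
        C * B * (t - T) + C * B / (ν * lam) := by
      field_simp
    have hconst : C * B / (ν * lam) ≤ μ / (ν * lam) :=
      div_le_div_of_nonneg_right (by linarith) ha.le
    have hlin := mul_le_mul_of_nonneg_right hμB (sub_nonneg.2 ht)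
    linarith
  refine ⟨hdecay, ?_⟩
  refine tendsto_of_tendsto_of_tendsto_of_le_of_le' tendsto_const_nhds ?_
    ((Filter.eventually_ge_atTop T).mono hY_nonneg) ((Filter.eventually_ge_atTop T).mono hdecay)
  have hexp : Filter.Tendsto (fun t => Real.exp (-(C * B) * (t - T))) Filter.atTop (nhds 0) :=
    Real.tendsto_exp_atBot.comp ((Filter.tendsto_atTop_add_const_right _ (-T)
      Filter.tendsto_id).const_mul_atTop_of_neg (neg_neg_of_pos hCB))
  simpa using hexp.const_mul (Y T * Real.exp (μ / (ν * lam)))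
end

section
/- Feedback-minus-noise decay corollary: Let τ, μ, B be positive real numbers with μ·τ > B, and let T be a real number. Let β : ℝ → ℝ be continuous and nonnegative with ∫_t^{t+τ} β(s) ds ≤ B for every t ≥ T. Let Y : ℝ → ℝ be differentiable and nonnegative on [T,∞) with Y′(t) + (μ − β(t))·Y(t) ≤ 0 for all t ≥ T. Then for every t ≥ T, Y(t) ≤ Y(T)·exp(μ·τ)·exp(−((μ·τ − B)/τ)·(t − T)); in particular Y decays to zero exponentially fast. -/
/-- If every window of length `τ` starting after `T` carries at most `B`, then `n` consecutive
windows carry at most `n * B`. -/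
lemma intervalIntegral_le_nat_mul_of_window_le {τ B T : ℝ} (hτ : 0 ≤ τ) {β : ℝ → ℝ}
    (hβ_cont : Continuous β) (hβ_int : ∀ t, T ≤ t → (∫ s in t..(t + τ), β s) ≤ B) (n : ℕ) :
    (∫ s in T..(T + n * τ), β s) ≤ n * B := by
  induction n with
  | zero => simp
  | succ n ih =>
    have hstart : T ≤ T + n * τ := le_add_of_nonneg_right (by positivity)
    have hend : T + ((n + 1 : ℕ) : ℝ) * τ = T + n * τ + τ := by push_cast; ring
    rw [hend, ← intervalIntegral.integral_add_adjacent_intervals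
      (hβ_cont.intervalIntegrable T (T + n * τ)) (hβ_cont.intervalIntegrable _ _)]
    have := hβ_int _ hstart
    push_cast
    linarith

/-- A nonnegative function whose integral over windows of length `τ` is at most `B` has integral
at most `B * ((t - T) / τ + 1)` over `[T, t]`. -/
lemma intervalIntegral_le_mul_div_add_one_of_window_le {τ B T t : ℝ} (hτ : 0 < τ) (hB : 0 ≤ B)
    {β : ℝ → ℝ} (hβ_cont : Continuous β) (hβ_nonneg : ∀ s, 0 ≤ β s)
    (hβ_int : ∀ t, T ≤ t → (∫ s in t..(t + τ), β s) ≤ B) (ht : T ≤ t) :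
    (∫ s in T..t, β s) ≤ B * ((t - T) / τ + 1) := by
  set n := ⌈(t - T) / τ⌉₊
  have hcover : t ≤ T + n * τ := by
    have := (div_le_iff₀ hτ).1 (Nat.le_ceil ((t - T) / τ))
    linarith
  have hn : (n : ℝ) ≤ (t - T) / τ + 1 :=
    (Nat.ceil_lt_add_one (div_nonneg (sub_nonneg.2 ht) hτ.le)).le
  calc (∫ s in T..t, β s) ≤ ∫ s in T..(T + n * τ), β s :=
        intervalIntegral.integral_mono_interval le_rfl ht hcover
          (Filter.Eventually.of_forall hβ_nonneg) (hβ_cont.intervalIntegrable _ _)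
    _ ≤ n * B := intervalIntegral_le_nat_mul_of_window_le hτ.le hβ_cont hβ_int n
    _ ≤ B * ((t - T) / τ + 1) := by
        rw [mul_comm]
        exact mul_le_mul_of_nonneg_left hn hB

/-- Grönwall's inequality for `Y' + α Y ≤ 0` with a continuous rate `α`. -/
lemma le_mul_exp_neg_integral_of_deriv_add_mul_le_zero {T t : ℝ} {α Y Y' : ℝ → ℝ}
    (hα : Continuous α) (hY_deriv : ∀ t, T ≤ t → HasDerivAt Y (Y' t) t)
    (hY_ineq : ∀ t, T ≤ t → Y' t + α t * Y t ≤ 0) (ht : T ≤ t) :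
    Y t ≤ Y T * Real.exp (-∫ s in T..t, α s) := by
  have hderiv : ∀ x, T ≤ x → HasDerivAt (fun x => Y x * Real.exp (∫ s in T..x, α s))
      ((Y' x + α x * Y x) * Real.exp (∫ s in T..x, α s)) x := fun x hx => by
    refine ((hY_deriv x hx).mul
      (hα.integral_hasStrictDerivAt T x).hasDerivAt.exp).congr_deriv ?_
    ring
  have hanti : AntitoneOn (fun x => Y x * Real.exp (∫ s in T..x, α s)) (Set.Ici T) := by
    refine antitoneOn_of_hasDerivWithinAt_nonpos (convex_Ici T)
      (fun x hx => (hderiv x hx).continuousAt.continuousWithinAt)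
      (fun x hx => (hderiv x (interior_subset hx)).hasDerivWithinAt) fun x hx => ?_
    exact mul_nonpos_of_nonpos_of_nonneg (hY_ineq x (interior_subset hx)) (Real.exp_pos _).le
  have hle : Y t * Real.exp (∫ s in T..t, α s) ≤ Y T := by
    simpa using hanti Set.self_mem_Ici ht ht
  rwa [Real.exp_neg, ← div_eq_mul_inv, le_div_iff₀ (Real.exp_pos _)]


/-- Feedback-minus-noise decay corollary: exponential synchronization from
the error inequality with sliding-window control of the noise term. -/
theorem feedback_minus_noise_decay
    (τ μ B T : ℝ) (hτ : 0 < τ) (hμ : 0 < μ) (hB : 0 < B)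
    (hμτ : B < μ * τ)
    (β : ℝ → ℝ) (hβ_cont : Continuous β) (hβ_nonneg : ∀ s, 0 ≤ β s)
    (hβ_int : ∀ t, T ≤ t → (∫ s in t..(t + τ), β s) ≤ B)
    (Y Y' : ℝ → ℝ)
    (hY_deriv : ∀ t, T ≤ t → HasDerivAt Y (Y' t) t)
    (hY_nonneg : ∀ t, T ≤ t → 0 ≤ Y t)
    (hY_ineq : ∀ t, T ≤ t → Y' t + (μ - β t) * Y t ≤ 0) :
    (∀ t, T ≤ t →
      Y t ≤ Y T * Real.exp (μ * τ) * Real.exp (-((μ * τ - B) / τ) * (t - T)))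
    ∧ Filter.Tendsto Y Filter.atTop (nhds 0) := by
  have hbound : ∀ t, T ≤ t →
      Y t ≤ Y T * Real.exp (μ * τ) * Real.exp (-((μ * τ - B) / τ) * (t - T)) := fun t ht => by
    refine (le_mul_exp_neg_integral_of_deriv_add_mul_le_zero
      (α := fun s => μ - β s) (continuous_const.sub hβ_cont) hY_deriv hY_ineq ht).trans ?_
    rw [mul_assoc, ← Real.exp_add]
    refine mul_le_mul_of_nonneg_left (Real.exp_le_exp.2 ?_) (hY_nonneg T le_rfl)
    have hwindow := intervalIntegral_le_mul_div_add_one_of_window_le hτ hB.le hβ_cont hβ_nonneg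
      hβ_int ht
    rw [intervalIntegral.integral_sub (continuous_const.intervalIntegrable _ _)
      (hβ_cont.intervalIntegrable _ _), intervalIntegral.integral_const, smul_eq_mul]
    have hrate : -((μ * τ - B) / τ) * (t - T) = -((t - T) * μ) + B * ((t - T) / τ) := by
      field_simp
      ring
    rw [hrate]
    linarith
  refine ⟨hbound, squeeze_zero' ((Filter.eventually_ge_atTop T).mono hY_nonneg)
    ((Filter.eventually_ge_atTop T).mono hbound) ?_⟩
  have hrate : -((μ * τ - B) / τ) < 0 := neg_lt_zero.2 (div_pos (sub_pos.2 hμτ) hτ)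
  have hlin : Filter.Tendsto (fun t => -((μ * τ - B) / τ) * (t - T)) Filter.atTop Filter.atBot :=
    (Filter.tendsto_atTop_add_const_right _ (-T) Filter.tendsto_id).const_mul_atTop_of_neg hrate
  simpa using (Real.tendsto_exp_atBot.comp hlin).const_mul (Y T * Real.exp (μ * τ))
end

section
/- Exponential comparison with rate extraction: Let τ, γ, M be positive real numbers, T a real number, and α : ℝ → ℝ continuous with α(s) ≤ M for all s ≥ T and ∫_t^{t+τ} α(s) ds ≥ γ for all t ≥ T. Then for every t ≥ T, ∫_T^t α(s) ds ≥ (γ/τ)·(t − T) − M·τ. -/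
/-- If every window of length `τ` starting at or after `T` contributes at least `γ` to the integral
of `α`, then `n` consecutive windows starting at `T` contribute at least `n * γ`. -/
theorem nat_mul_le_integral_of_le_window_integral {τ γ T : ℝ} {α : ℝ → ℝ} (hτ : 0 ≤ τ)
    (hα : Continuous α) (hα_int : ∀ t, T ≤ t → γ ≤ ∫ s in t..(t + τ), α s) (n : ℕ) :
    n * γ ≤ ∫ s in T..(T + n * τ), α s := by
  induction n with
  | zero => simp
  | succ n ih =>
    have hwindow := hα_int (T + n * τ) (le_add_of_nonneg_right (by positivity))
    have hsplit := intervalIntegral.integral_add_adjacent_intervals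
      (hα.intervalIntegrable (μ := MeasureTheory.volume) T (T + n * τ))
      (hα.intervalIntegrable (T + n * τ) (T + n * τ + τ))
    have hend : T + ((n + 1 : ℕ) : ℝ) * τ = T + n * τ + τ := by push_cast; ring
    rw [hend, ← hsplit]
    push_cast
    linarith

/-- Exponential comparison with rate extraction: quantitative lower bound
for the integral of the coefficient over `[T, t]`. -/
theorem window_integral_rate_extraction
    (τ γ M T : ℝ) (hτ : 0 < τ) (hγ : 0 < γ) (hM : 0 < M)
    (α : ℝ → ℝ) (hα_cont : Continuous α)
    (hα_bdd : ∀ s, T ≤ s → α s ≤ M)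
    (hα_int : ∀ t, T ≤ t → γ ≤ ∫ s in t..(t + τ), α s) :
    ∀ t, T ≤ t → (γ / τ) * (t - T) - M * τ ≤ ∫ s in T..t, α s := by
  intro t ht
  set n := ⌊(t - T) / τ⌋₊
  have hn_le : n * τ ≤ t - T :=
    (le_div_iff₀ hτ).1 (Nat.floor_le (div_nonneg (sub_nonneg.2 ht) hτ.le))
  have hlt_n : (t - T) / τ < n + 1 := Nat.lt_floor_add_one _
  have ht_le : t ≤ T + (n + 1) * τ := by
    linarith [(div_lt_iff₀ hτ).1 hlt_n]
  have hfull : (n + 1) * γ ≤ ∫ s in T..(T + (n + 1) * τ), α s :=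
    mod_cast nat_mul_le_integral_of_le_window_integral hτ.le hα_cont hα_int (n + 1)
  have hrest : ∫ s in t..(T + (n + 1) * τ), α s ≤ M * τ := calc
    _ ≤ ∫ _ in t..(T + (n + 1) * τ), M :=
      intervalIntegral.integral_mono_on ht_le (hα_cont.intervalIntegrable _ _)
        intervalIntegrable_const fun s hs => hα_bdd s (ht.trans hs.1)
    _ = M * (T + (n + 1) * τ - t) := by
      rw [intervalIntegral.integral_const, smul_eq_mul, mul_comm]
    _ ≤ M * τ := mul_le_mul_of_nonneg_left (by linarith) hM.le
  have hsplit := intervalIntegral.integral_add_adjacent_intervals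
    (hα_cont.intervalIntegrable (μ := MeasureTheory.volume) T t)
    (hα_cont.intervalIntegrable t (T + (n + 1) * τ))
  have hrate : γ / τ * (t - T) ≤ (n + 1) * γ := by
    rw [div_mul_comm]
    exact mul_le_mul_of_nonneg_right hlt_n.le hγ.le
  linarith
end
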